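/- arXiv:1809.07461 — 2 statements merged into one kernel-verified Lean document; each statement's English description precedes it below -/
import Mathlib

section
/- Let j ≥ 2 and let ξ ≥ 1 be an integer. Suppose B_0, ..., B_{j-1} are nonnegative integers satisfying B_{j-l} ≤ (ξ+1)^{2^{j-l}} - 1 for all 1 ≤ l ≤ j, and let e_j be an integer with |e_j| ≤ ξ. Define B_j = (-1)^j e_j + Σ_{l=1}^{j} (-1)^{l-1} binomial(B_{j-l} + 1, l+1). Then B_j ≤ (ξ+1)^{2^j} - 1. -/
theorem aux_fact (l : ℕ) : 2 ^ l ≤ (l + 1).factorial := by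
  induction l with
  | zero => simp
  | succ k ih =>
    rw [Nat.factorial_succ, pow_succ, mul_comm]
    exact Nat.mul_le_mul (by omega) ih

theorem aux_choose (N l : ℕ) : N.choose (l + 1) * 2 ^ l ≤ N ^ (l + 1) := by
  calc N.choose (l + 1) * 2 ^ l ≤ N.choose (l + 1) * (l + 1).factorial :=
        Nat.mul_le_mul_left _ (aux_fact l)
    _ = N.descFactorial (l + 1) := by
        rw [Nat.descFactorial_eq_factorial_mul_choose, mul_comm]
    _ ≤ N ^ (l + 1) := Nat.descFactorial_le_pow _ _

theorem aux_exp (j l : ℕ) (h : l ≤ j) : 2 ^ (j - l) * (l + 1) ≤ 2 ^ j := by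
  calc 2 ^ (j - l) * (l + 1) ≤ 2 ^ (j - l) * 2 ^ l :=
        Nat.mul_le_mul_left _ (Nat.lt_two_pow_self)
    _ = 2 ^ j := by rw [← pow_add, Nat.sub_add_cancel h]

theorem aux_sum (M : ℚ) (f : ℕ → ℚ) (j : ℕ) (hj : 1 ≤ j)
    (hf : ∀ l, 2 ≤ l → l ≤ j → f l ≤ M / 2 ^ l) :
    ∑ l ∈ Finset.Icc 1 j, f l ≤ f 1 + M / 2 - M / 2 ^ j := by
  induction j, hj using Nat.le_induction with
  | base => simp
  | succ n hn ih =>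
    rw [Finset.sum_Icc_succ_top (by omega)]
    have h1 := ih (fun l h h' => hf l h (by omega))
    have h2 := hf (n + 1) (by omega) le_rfl
    have h3 : M / 2 ^ n = 2 * (M / 2 ^ (n + 1)) := by
      rw [pow_succ]; field_simp
    linarith

/-- Inductive step in the proof of Theorem 2.1: if `j ≥ 2`, `ξ ≥ 1`,
`B_{j-l} ≤ (ξ+1)^{2^{j-l}} - 1` for `1 ≤ l ≤ j`, `|e_j| ≤ ξ`, and
`B_j = (-1)^j e_j + Σ_{l=1}^{j} (-1)^{l-1} C(B_{j-l} + 1, l + 1)`,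
then `B_j ≤ (ξ+1)^{2^j} - 1`. -/
theorem stmt2 (j : ℕ) (hj : 2 ≤ j) (ξ : ℤ) (hξ : 1 ≤ ξ) (B : ℕ → ℤ)
    (hBnn : ∀ i < j, 0 ≤ B i)
    (hind : ∀ l, 1 ≤ l → l ≤ j → B (j - l) ≤ (ξ + 1) ^ (2 ^ (j - l)) - 1)
    (e : ℤ) (he : |e| ≤ ξ)
    (hBj : B j = (-1) ^ j * e +
      ∑ l ∈ Finset.Icc 1 j, (-1) ^ (l - 1) * ((B (j - l) + 1).toNat.choose (l + 1) : ℤ)) :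
    B j ≤ (ξ + 1) ^ (2 ^ j) - 1 := by
  obtain ⟨X, hX⟩ : ∃ X : ℕ, ξ + 1 = (X : ℤ) := ⟨(ξ + 1).toNat, by omega⟩
  have hX2 : 2 ≤ X := by omega
  have hN : ∀ l, 1 ≤ l → l ≤ j → (B (j - l) + 1).toNat ≤ X ^ 2 ^ (j - l) := by
    intro l h1 h2
    have := hind l h1 h2
    rw [hX] at this
    have h3 : B (j - l) + 1 ≤ ((X ^ 2 ^ (j - l) : ℕ) : ℤ) := by push_cast; linarith
    omega
  have hterm : ∀ l, 1 ≤ l → l ≤ j →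
      (B (j - l) + 1).toNat.choose (l + 1) * 2 ^ l ≤ X ^ 2 ^ j := by
    intro l h1 h2
    calc _ ≤ (B (j - l) + 1).toNat ^ (l + 1) := aux_choose _ _
      _ ≤ (X ^ 2 ^ (j - l)) ^ (l + 1) := Nat.pow_le_pow_left (hN l h1 h2) _
      _ = X ^ (2 ^ (j - l) * (l + 1)) := by rw [pow_mul]
      _ ≤ X ^ 2 ^ j := Nat.pow_le_pow_right (by omega) (aux_exp j l h2)
  have hsum := aux_sum ((X : ℚ) ^ 2 ^ j)
    (fun l => (-1) ^ (l - 1) * ((B (j - l) + 1).toNat.choose (l + 1) : ℚ)) j (by omega) (by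
      intro l h1 h2
      have h := hterm l (by omega) h2
      have h' : ((B (j - l) + 1).toNat.choose (l + 1) : ℚ) * 2 ^ l ≤ (X : ℚ) ^ 2 ^ j := by
        exact_mod_cast h
      rw [le_div_iff₀ (by positivity)]
      have h0 : (0 : ℚ) ≤ ((B (j - l) + 1).toNat.choose (l + 1) : ℚ) * 2 ^ l := by positivity
      rcases neg_one_pow_eq_or ℚ (l - 1) with h3 | h3 <;> simp only [h3] <;> linarith)
  -- first term
  set N := (B (j - 1) + 1).toNat with hNdef
  set Y := X ^ 2 ^ (j - 1) with hY
  have hNY : N ≤ Y := hN 1 le_rfl (by omega)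
  have hYY : (X : ℚ) ^ 2 ^ j = (Y : ℚ) * Y := by
    obtain ⟨k, rfl⟩ : ∃ k, j = k + 1 := ⟨j - 1, by omega⟩
    simp only [hY, Nat.add_sub_cancel]
    push_cast
    rw [pow_succ, pow_mul, sq]
  have hXY : 2 * X ≤ Y := by
    have h2 : 2 ≤ 2 ^ (j - 1) := by
      calc 2 = 2 ^ 1 := rfl
        _ ≤ 2 ^ (j - 1) := Nat.pow_le_pow_right (by omega) (by omega)
    calc 2 * X ≤ X * X := Nat.mul_le_mul_right _ hX2
      _ = X ^ 2 := (sq X).symm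
      _ ≤ Y := Nat.pow_le_pow_right (by omega) h2
  have hc : (N.choose 2 : ℚ) ≤ (Y : ℚ) * (Y - 1) / 2 := by
    rw [← Nat.cast_choose_two]
    exact_mod_cast Nat.choose_le_choose 2 hNY
  have hXYq : 2 * (X : ℚ) ≤ Y := by exact_mod_cast hXY
  have heb : (-1) ^ j * e ≤ ξ := by
    have := abs_le.mp he
    rcases neg_one_pow_eq_or ℤ j with h3 | h3 <;> rw [h3] <;> linarith
  have hebq : ((((-1) ^ j * e : ℤ)) : ℚ) ≤ (X : ℚ) - 1 := by
    have : (-1) ^ j * e ≤ (X : ℤ) - 1 := by linarith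
    exact_mod_cast this
  have hpos : (0 : ℚ) ≤ (X : ℚ) ^ 2 ^ j / 2 ^ j := by positivity
  have hBq : (B j : ℚ) = (((-1) ^ j * e : ℤ) : ℚ) +
      ∑ l ∈ Finset.Icc 1 j, (-1) ^ (l - 1) * ((B (j - l) + 1).toNat.choose (l + 1) : ℚ) := by
    rw [hBj]; push_cast; rfl
  simp only [Nat.sub_self, pow_zero, one_mul, ← hNdef, Nat.reduceAdd] at hsum
  have hfin : (B j : ℚ) ≤ (X : ℚ) ^ 2 ^ j - 1 := by
    rw [hBq]
    rw [hYY] at hsum hpos ⊢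
    linarith
  rw [hX]
  exact_mod_cast hfin
end

section
/- Let (A, m) be a Noetherian local ring of dimension d ≥ 1 with infinite residue field and I an m-primary ideal such that A/I is equicharacteristic. Then for all 1 ≤ i ≤ d, (-1)^{i-1} e_i(I) < (7/12)(ξ_{i-1}(I) + 1)^{2^i} - e_0(I). -/
/-- `HasLength R M n`: the `R`-module `M` has a composition series from `⊥` to `⊤`
of length `n`, i.e. `M` has (Jordan–Hölder) length `n`. -/
def HasLength (R M : Type*) [Ring R] [AddCommGroup M] [Module R M] (n : ℕ) : Prop :=
  ∃ s : CompositionSeries (Submodule R M), s.head = ⊥ ∧ s.last = ⊤ ∧ s.length = n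

namespace HB

set_option linter.unusedSectionVars false

theorem lowerSet_wf {P : Type*} [PartialOrder P] [WellQuasiOrderedLE P] :
    WellFounded (fun a b : LowerSet P => a < b) := by
  rw [RelEmbedding.wellFounded_iff_isEmpty]
  constructor
  intro f
  have hlt : ∀ i j, i < j → f j < f i := fun i j hij => f.map_rel_iff.2 hij
  have hex : ∀ n, ∃ a, a ∈ f n ∧ a ∉ f (n + 1) := by
    intro n
    by_contra hcon
    push Not at hcon
    exact (hlt n (n + 1) (Nat.lt_succ_self n)).not_ge hcon
  choose a ha hb using hex
  obtain ⟨i, j, hij, hle⟩ := (wellQuasiOrdered_le (α := P)) a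
  have h1 : f j ≤ f (i + 1) := by
    rcases (Nat.succ_le_of_lt hij).eq_or_lt with h | h
    · rw [← h]
    · exact (hlt _ _ h).le
  exact hb i ((f (i + 1)).lower hle (h1 (ha j)))

variable {ι : Type*} [Fintype ι] [DecidableEq ι]

/-- monomials of `Γ` in the variables `u` of degree at most `n` -/
def cset (u : Finset ι) (Γ : Set (ι → ℕ)) (n : ℕ) : Set (ι → ℕ) :=
  {α | α ∈ Γ ∧ (∀ i, i ∉ u → α i = 0) ∧ ∑ i, α i ≤ n}

theorem deg_finite (n : ℕ) : {α : ι → ℕ | ∑ i, α i ≤ n}.Finite := by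
  apply (Set.finite_Iic (fun _ : ι => n)).subset
  intro α hα i
  exact (Finset.single_le_sum (f := α) (fun _ _ => Nat.zero_le _) (Finset.mem_univ i)).trans hα

theorem cset_finite (u : Finset ι) (Γ : Set (ι → ℕ)) (n : ℕ) : (cset u Γ n).Finite :=
  (deg_finite n).subset fun _ h => h.2.2

noncomputable def cnt (u : Finset ι) (Γ : Set (ι → ℕ)) (n : ℕ) : ℕ := (cset u Γ n).ncard

/-- the colon set -/
def colon (Γ : LowerSet (ι → ℕ)) (x : ι) : LowerSet (ι → ℕ) where
  carrier := {α | α + Pi.single x 1 ∈ Γ}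
  lower' := by
    intro a b hab ha
    exact Γ.lower (add_le_add_left hab _) ha

theorem mem_colon {Γ : LowerSet (ι → ℕ)} {x : ι} {α : ι → ℕ} :
    α ∈ colon Γ x ↔ α + Pi.single x 1 ∈ Γ := Iff.rfl

theorem colon_le (Γ : LowerSet (ι → ℕ)) (x : ι) : colon Γ x ≤ Γ := by
  intro α hα
  exact Γ.lower (fun i => by simp) hα

theorem sum_add_single (α : ι → ℕ) (x : ι) :
    ∑ i, (α + Pi.single x 1 : ι → ℕ) i = ∑ i, α i + 1 := by
  simp [Finset.sum_add_distrib]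

theorem cset_split (u : Finset ι) (x : ι) (hx : x ∈ u) (Γ : LowerSet (ι → ℕ)) (n : ℕ) :
    cset u (Γ : Set (ι → ℕ)) (n + 1) = cset (u.erase x) (Γ : Set (ι → ℕ)) (n + 1) ∪
      Set.image (fun α => α + Pi.single x 1) (cset u (colon Γ x : Set (ι → ℕ)) n) := by
  ext α
  constructor
  · rintro ⟨h1, h2, h3⟩
    by_cases h : α x = 0
    · left
      refine ⟨h1, fun i hi => ?_, h3⟩
      by_cases hix : i = x
      · rw [hix, h]
      · exact h2 i (fun h' => hi (Finset.mem_erase.2 ⟨hix, h'⟩))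
    · right
      have hs : α - Pi.single x 1 + Pi.single x 1 = α := by
        funext i
        by_cases hix : i = x
        · subst hix; simp; omega
        · simp [hix]
      refine ⟨α - Pi.single x 1, ⟨?_, ?_, ?_⟩, hs⟩
      · show α - Pi.single x 1 + Pi.single x 1 ∈ Γ
        rw [hs]; exact h1
      · intro i hi
        simp [h2 i hi]
      · have := sum_add_single (α - Pi.single x 1) x
        rw [hs] at this
        omega
  · rintro (⟨h1, h2, h3⟩ | ⟨β, ⟨h1, h2, h3⟩, rfl⟩)
    · exact ⟨h1, fun i hi => h2 i (fun h => hi (Finset.mem_of_mem_erase h)), h3⟩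
    · refine ⟨h1, fun i hi => ?_, ?_⟩
      · have : i ≠ x := fun h => hi (h ▸ hx)
        simp [h2 i hi, this]
      · have := sum_add_single β x
        simp only at this ⊢
        omega

theorem cnt_split (u : Finset ι) (x : ι) (hx : x ∈ u) (Γ : LowerSet (ι → ℕ)) (n : ℕ) :
    cnt u (Γ : Set (ι → ℕ)) (n + 1) = cnt (u.erase x) (Γ : Set (ι → ℕ)) (n + 1) +
      cnt u (colon Γ x : Set (ι → ℕ)) n := by
  unfold cnt
  rw [cset_split u x hx, Set.ncard_union_eq _ (cset_finite _ _ _) ((cset_finite _ _ _).image _),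
    Set.ncard_image_of_injective]
  · exact fun a b h => add_right_cancel h
  · rw [Set.disjoint_left]
    rintro α ⟨_, h2, _⟩ ⟨β, _, rfl⟩
    have := h2 x (by simp)
    simp at this

theorem cset_zero (u : Finset ι) (Γ : LowerSet (ι → ℕ)) (h0 : (0 : ι → ℕ) ∈ Γ) :
    cset u (Γ : Set (ι → ℕ)) 0 = {0} := by
  ext α
  constructor
  · rintro ⟨_, _, h⟩
    have : ∀ i, α i = 0 := by simpa using h
    exact funext this
  · rintro rfl
    exact ⟨h0, by simp, by simp⟩

theorem cnt_zero (u : Finset ι) (Γ : LowerSet (ι → ℕ)) (h0 : (0 : ι → ℕ) ∈ Γ) :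
    cnt u (Γ : Set (ι → ℕ)) 0 = 1 := by
  rw [cnt, cset_zero u Γ h0, Set.ncard_singleton]

theorem cnt_top (n : ℕ) : ∀ u : Finset ι,
    cnt u ((⊤ : LowerSet (ι → ℕ)) : Set (ι → ℕ)) n = (n + u.card).choose u.card := by
  induction n with
  | zero => intro u; rw [cnt_zero u ⊤ (by simp)]; simp
  | succ n ihn =>
    intro u
    induction u using Finset.induction_on with
    | empty =>
      have : cset (∅ : Finset ι) ((⊤ : LowerSet (ι → ℕ)) : Set (ι → ℕ)) (n + 1) = {0} := by
        ext α
        constructor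
        · rintro ⟨_, h, _⟩
          exact funext fun i => h i (by simp)
        · rintro rfl
          exact ⟨trivial, by simp, by simp⟩
      rw [cnt, this]; simp
    | insert x u hx ih =>
      rw [cnt_split _ x (Finset.mem_insert_self _ _)]
      have h1 : colon (⊤ : LowerSet (ι → ℕ)) x = ⊤ := by
        ext; simp [colon]
      rw [h1, ihn, Finset.erase_insert hx, ih, Finset.card_insert_of_notMem hx]
      have := Nat.choose_succ_succ (n + 1 + u.card) u.card
      rw [show n + 1 + (u.card + 1) = (n + 1 + u.card).succ by omega, this]
      rw [show n + (u.card + 1) = n + 1 + u.card by omega]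

/-- size of a cone -/
def cone (n : ℕ) (p : ℕ × ℕ) : ℕ := if p.1 ≤ n then (n - p.1 + p.2).choose p.2 else 0

/-- `q`-standard -/
def Std (q : ℕ) (T : Multiset (ℕ × ℕ)) : Prop :=
  ∀ p ∈ T, ∀ j, q ≤ j → j ≤ p.1 → ∃ p' ∈ T, p'.1 = j ∧ p.2 ≤ p'.2

/-- `s` is a free set of variables -/
def Free (Γ : LowerSet (ι → ℕ)) (s : Finset ι) : Prop :=
  ∀ α : ι → ℕ, (∀ i, i ∉ s → α i = 0) → α ∈ Γ

theorem decomp (u : Finset ι) : ∀ Γ : LowerSet (ι → ℕ), ∃ T : Multiset (ℕ × ℕ),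
    (∀ n, cnt u (Γ : Set (ι → ℕ)) n = (T.map (cone n)).sum) ∧ Std 0 T ∧
    (∀ p ∈ T, ∃ s ⊆ u, Free Γ s ∧ p.2 ≤ s.card) ∧
    (∀ s ⊆ u, Free Γ s → ∃ p ∈ T, p.1 = 0 ∧ s.card ≤ p.2) := by
  induction u using Finset.strongInduction with
  | H u ihu =>
  intro Γ
  refine (lowerSet_wf (P := ι → ℕ)).induction (C := fun Γ => ∃ T : Multiset (ℕ × ℕ),
    (∀ n, cnt u (Γ : Set (ι → ℕ)) n = (T.map (cone n)).sum) ∧ Std 0 T ∧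
    (∀ p ∈ T, ∃ s ⊆ u, Free Γ s ∧ p.2 ≤ s.card) ∧
    (∀ s ⊆ u, Free Γ s → ∃ p ∈ T, p.1 = 0 ∧ s.card ≤ p.2)) Γ ?_
  clear Γ
  intro Γ ihΓ
  by_cases h0 : (0 : ι → ℕ) ∈ Γ
  swap
  · refine ⟨0, ?_, ?_, ?_, ?_⟩
    · intro n
      have : cset u (Γ : Set (ι → ℕ)) n = ∅ := by
        rw [Set.eq_empty_iff_forall_notMem]
        rintro α ⟨h, _⟩
        exact h0 (Γ.lower (fun i => Nat.zero_le _) h)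
      simp [cnt, this]
    · intro p hp; simp at hp
    · intro p hp; simp at hp
    · intro s _ hs
      exact absurd (hs 0 (by simp)) h0
  by_cases hu : Free Γ u
  · refine ⟨{(0, u.card)}, ?_, ?_, ?_, ?_⟩
    · intro n
      have : cset u (Γ : Set (ι → ℕ)) n = cset u ((⊤ : LowerSet (ι → ℕ)) : Set (ι → ℕ)) n := by
        ext α
        exact ⟨fun h => ⟨trivial, h.2⟩, fun h => ⟨hu α h.2.1, h.2⟩⟩
      rw [cnt, this, ← cnt, cnt_top]
      simp [cone]
    · intro p hp j _ hj
      rw [Multiset.mem_singleton] at hp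
      subst hp
      exact ⟨(0, u.card), by simp, by simp at hj; simp [hj], le_rfl⟩
    · intro p hp
      rw [Multiset.mem_singleton] at hp
      subst hp
      exact ⟨u, le_rfl, hu, le_rfl⟩
    · intro s hs _
      exact ⟨(0, u.card), by simp, rfl, Finset.card_le_card hs⟩
  -- maximal free set
  have hfe : Free Γ ∅ := by
    intro α hα
    have : α = 0 := funext fun i => hα i (by simp)
    rw [this]; exact h0
  classical
  obtain ⟨s, hsm, hmax⟩ := Finset.exists_max_image (u.powerset.filter (Free Γ)) Finset.card
    ⟨∅, by simp [hfe]⟩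
  rw [Finset.mem_filter, Finset.mem_powerset] at hsm
  obtain ⟨hsu, hsf⟩ := hsm
  have hne : s ≠ u := fun h => hu (h ▸ hsf)
  obtain ⟨x, hxu, hxs⟩ := Finset.exists_of_ssubset (hsu.ssubset_of_ne hne)
  have hlt : colon Γ x < Γ := by
    refine lt_of_le_of_ne (colon_le Γ x) ?_
    intro heq
    have hfree : Free Γ (insert x s) := by
      have key : ∀ k, ∀ α : ι → ℕ, α x = k → (∀ i, i ∉ insert x s → α i = 0) → α ∈ Γ := by
        intro k
        induction k with
        | zero =>
          intro α hk hα
          apply hsf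
          intro i hi
          by_cases hix : i = x
          · rw [hix, hk]
          · exact hα i (by simp [hix, hi])
        | succ k ih =>
          intro α hk hα
          have hs : α - Pi.single x 1 + Pi.single x 1 = α := by
            funext i
            by_cases hix : i = x
            · subst hix; simp; omega
            · simp [hix]
          rw [← hs, ← mem_colon, heq]
          apply ih
          · simp [hk]
          · intro i hi
            simp [hα i hi]
      intro α hα
      exact key _ α rfl hα
    have := hmax (insert x s) (by
      rw [Finset.mem_filter, Finset.mem_powerset]
      exact ⟨Finset.insert_subset hxu hsu, hfree⟩)
    rw [Finset.card_insert_of_notMem hxs] at this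
    omega
  obtain ⟨T0, c0, st0, d0, f0⟩ := ihu (u.erase x) (Finset.erase_ssubset hxu) Γ
  obtain ⟨T1, c1, st1, d1, f1⟩ := ihΓ (colon Γ x) hlt
  have hsx : s ⊆ u.erase x := fun i hi =>
    Finset.mem_erase.2 ⟨fun h => hxs (h ▸ hi), hsu hi⟩
  have hfl : ∀ t, Free (colon Γ x) t → Free Γ t := fun t ht α hα => colon_le Γ x (ht α hα)
  refine ⟨T0 + T1.map (fun p => (p.1 + 1, p.2)), ?_, ?_, ?_, ?_⟩
  · intro n
    rw [Multiset.map_add, Multiset.sum_add, ← c0 n, Multiset.map_map]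
    rcases n with _ | n
    · rw [cnt_zero _ _ h0, cnt_zero _ _ h0]
      have : T1.map (cone 0 ∘ fun p => (p.1 + 1, p.2)) = T1.map (fun _ => 0) := by
        apply Multiset.map_congr rfl
        intro p _
        simp [cone]
      rw [this]; simp
    · rw [cnt_split _ x hxu, c1 n]
      congr 2
      apply Multiset.map_congr rfl
      intro p _
      simp [cone]
  · intro p hp j _ hj
    rw [Multiset.mem_add] at hp
    rcases hp with hp | hp
    · obtain ⟨p', h1, h2⟩ := st0 p hp j (Nat.zero_le _) hj
      exact ⟨p', Multiset.mem_add.2 (Or.inl h1), h2⟩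
    · rw [Multiset.mem_map] at hp
      obtain ⟨r, hr, rfl⟩ := hp
      rcases j with _ | j
      · obtain ⟨t, htu, htf, htc⟩ := d1 r hr
        have h1 := hmax t (by
          rw [Finset.mem_filter, Finset.mem_powerset]
          exact ⟨htu, hfl t htf⟩)
        obtain ⟨p', h2, h3, h4⟩ := f0 s hsx hsf
        exact ⟨p', Multiset.mem_add.2 (Or.inl h2), h3, htc.trans (h1.trans h4)⟩
      · obtain ⟨p', h1, h2, h3⟩ := st1 r hr j (Nat.zero_le _) (by simpa using hj)
        exact ⟨(p'.1 + 1, p'.2), Multiset.mem_add.2 (Or.inr (Multiset.mem_map.2 ⟨p', h1, rfl⟩)),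
          by simp [h2], h3⟩
  · intro p hp
    rw [Multiset.mem_add] at hp
    rcases hp with hp | hp
    · obtain ⟨t, ht, h⟩ := d0 p hp
      exact ⟨t, ht.trans (Finset.erase_subset _ _), h⟩
    · rw [Multiset.mem_map] at hp
      obtain ⟨r, hr, rfl⟩ := hp
      obtain ⟨t, ht, h1, h2⟩ := d1 r hr
      exact ⟨t, ht, hfl t h1, h2⟩
  · intro t htu htf
    have h1 := hmax t (by
      rw [Finset.mem_filter, Finset.mem_powerset]
      exact ⟨htu, htf⟩)
    obtain ⟨p', h2, h3, h4⟩ := f0 s hsx hsf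
    exact ⟨p', Multiset.mem_add.2 (Or.inl h2), h3, h1.trans h4⟩

end HB

namespace HB

/-- coefficients of `C(n-b+a,a)` in the basis `C(n+k,k)` -/
def K (b a k : ℕ) : ℤ := if k ≤ a then (-1) ^ (a - k) * ((b.choose (a - k) : ℕ) : ℤ) else 0

theorem K_zero (b b' k : ℕ) : K b 0 k = K b' 0 k := by
  unfold K
  by_cases h : k ≤ 0
  · have : k = 0 := by omega
    subst this; simp
  · simp [h]

theorem K_succ (b a k : ℕ) : K b (a + 1) k = K b a k + K (b + 1) (a + 1) k := by
  unfold K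
  by_cases h : k ≤ a
  · obtain ⟨c, rfl⟩ := Nat.exists_eq_add_of_le h
    have h1 : k ≤ k + c + 1 := by omega
    rw [if_pos h1, if_pos h, if_pos h1]
    rw [show k + c + 1 - k = c + 1 by omega, show k + c - k = c by omega, Nat.choose_succ_succ]
    push_cast
    ring
  · by_cases h1 : k ≤ a + 1
    · have : k = a + 1 := by omega
      subst this
      simp
    · simp [h, h1]

theorem K_zero_left (a k : ℕ) : K 0 a k = if k = a then 1 else 0 := by
  unfold K
  by_cases h : k = a
  · subst h; simp
  · by_cases h1 : k ≤ a
    · have : a - k ≠ 0 := by omega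
      obtain ⟨c, hc⟩ := Nat.exists_eq_succ_of_ne_zero this
      simp [h, hc]
    · simp [h, h1]

theorem cone_eq (N : ℕ) : ∀ b a n, b ≤ n → a < N →
    (((n - b + a).choose a : ℕ) : ℤ) = ∑ k ∈ Finset.range N, K b a k * (((n + k).choose k : ℕ) : ℤ) := by
  intro b
  induction b with
  | zero =>
    intro a n _ ha
    simp [K_zero_left, ha]
  | succ b ih =>
    intro a n hn ha
    rcases a with _ | a
    · rw [Finset.sum_congr rfl (fun k _ => by rw [K_zero (b + 1) b k]), ← ih 0 n (by omega) ha]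
      simp
    · have h1 := ih (a + 1) n (by omega) ha
      have h2 := ih a n (by omega) (by omega)
      have h3 : ∑ k ∈ Finset.range N, K (b + 1) (a + 1) k * (((n + k).choose k : ℕ) : ℤ) =
          ∑ k ∈ Finset.range N, K b (a + 1) k * (((n + k).choose k : ℕ) : ℤ) -
          ∑ k ∈ Finset.range N, K b a k * (((n + k).choose k : ℕ) : ℤ) := by
        rw [← Finset.sum_sub_distrib]
        refine Finset.sum_congr rfl fun k _ => ?_
        rw [K_succ b a k]; ring
      rw [h3, ← h1, ← h2]
      obtain ⟨c, rfl⟩ := Nat.exists_eq_add_of_le hn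
      rw [show b + 1 + c - (b + 1) + (a + 1) = c + a + 1 by omega,
        show b + 1 + c - b + (a + 1) = c + a + 1 + 1 by omega,
        show b + 1 + c - b + a = c + a + 1 by omega, Nat.choose_succ_succ (c + a + 1) a]
      push_cast; ring

theorem basis_unique : ∀ (N : ℕ) (c : ℕ → ℤ) (n0 : ℕ),
    (∀ n ≥ n0, ∑ k ∈ Finset.range N, c k * (((n + k).choose k : ℕ) : ℤ) = 0) →
    ∀ k < N, c k = 0 := by
  intro N
  induction N with
  | zero => intro c n0 _ k hk; omega
  | succ N ih =>
    intro c n0 h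
    have h1 : ∀ k < N, c (k + 1) = 0 := by
      apply ih (fun k => c (k + 1)) (n0 + 1)
      intro n hn
      obtain ⟨m, rfl⟩ := Nat.exists_eq_add_of_le' (show 1 ≤ n by omega)
      have e1 := h (m + 1) (by omega)
      have e2 := h m (by omega)
      rw [Finset.sum_range_succ'] at e1 e2
      have : ∑ k ∈ Finset.range N, c (k + 1) * (((m + 1 + k).choose k : ℕ) : ℤ) =
        ∑ k ∈ Finset.range N, c (k + 1) * (((m + 1 + (k + 1)).choose (k + 1) : ℕ) : ℤ) -
        ∑ k ∈ Finset.range N, c (k + 1) * (((m + (k + 1)).choose (k + 1) : ℕ) : ℤ) := by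
        rw [← Finset.sum_sub_distrib]
        refine Finset.sum_congr rfl fun k _ => ?_
        rw [show m + 1 + (k + 1) = m + 1 + k + 1 by omega, Nat.choose_succ_succ,
          show m + (k + 1) = m + 1 + k by omega]
        push_cast; ring
      rw [this]
      simp at e1 e2
      linarith
    intro k hk
    rcases k with _ | k
    · have e := h n0 le_rfl
      rw [Finset.sum_range_succ', Finset.sum_eq_zero] at e
      · simpa using e
      · intro k hk
        rw [h1 k (Finset.mem_range.1 hk)]; simp
    · exact h1 k (by omega)

theorem K_shift (a k : ℕ) : ∀ q b, b ≤ q → K b (a + 1) k =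
    K q (a + 1) k + ∑ i ∈ Finset.Ico b q, K i a k := by
  intro q b h
  induction q, h using Nat.le_induction with
  | base => simp
  | succ q h ih =>
    rw [ih, K_succ q a k, Finset.sum_Ico_succ_top h]; ring

theorem push (a : ℕ) : ∀ (m : ℕ) (B : Multiset ℕ) (q : ℕ), B.card = m →
    (∀ b ∈ B, ∀ j, q ≤ j → j ≤ b → j ∈ B) →
    (∀ b ∈ B, b < q + m) ∧ ∃ C : Multiset ℕ, (∀ c ∈ C, c < q + m) ∧
      ∀ k, (B.map fun b => K b (a + 1) k).sum =
        ∑ j ∈ Finset.Ico q (q + m), K j (a + 1) k + (C.map fun c => K c a k).sum := by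
  intro m
  induction m with
  | zero =>
    intro B q hB _
    rw [Multiset.card_eq_zero] at hB
    subst hB
    exact ⟨by simp, 0, by simp, by simp⟩
  | succ m ih =>
    intro B q hB hcl
    have hex : ∃ b ∈ B, b ≤ q := by
      have : 0 < B.card := by omega
      obtain ⟨b, hb⟩ := Multiset.card_pos_iff_exists_mem.1 this
      by_cases h : b ≤ q
      · exact ⟨b, hb, h⟩
      · exact ⟨q, hcl b hb q le_rfl (by omega), le_rfl⟩
    obtain ⟨b0, hb0, hbq⟩ := hex
    obtain ⟨B', rfl⟩ := Multiset.exists_cons_of_mem hb0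
    rw [Multiset.card_cons] at hB
    obtain ⟨h1, C, h2, h3⟩ := ih B' (q + 1) (by omega) (by
      intro b hb j hj1 hj2
      have := hcl b (Multiset.mem_cons_of_mem hb) j (by omega) hj2
      rw [Multiset.mem_cons] at this
      rcases this with h | h
      · omega
      · exact h)
    refine ⟨?_, C + (Finset.Ico b0 q).val, ?_, ?_⟩
    · intro b hb
      rw [Multiset.mem_cons] at hb
      rcases hb with h | h
      · omega
      · have := h1 b h; omega
    · intro c hc
      rw [Multiset.mem_add] at hc
      rcases hc with h | h
      · have := h2 c h; omega
      · have : c ∈ Finset.Ico b0 q := h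
        rw [Finset.mem_Ico] at this
        omega
    · intro k
      rw [Multiset.map_cons, Multiset.sum_cons, h3 k, K_shift a k q b0 hbq, Multiset.map_add,
        Multiset.sum_add, Finset.sum_eq_sum_Ico_succ_bot (show q < q + (m + 1) by omega),
        show q + 1 + m = q + (m + 1) by omega]
      have : ((Finset.Ico b0 q).val.map fun c => K c a k).sum = ∑ i ∈ Finset.Ico b0 q, K i a k := rfl
      rw [this]; ring

theorem gotzmann : ∀ (a q : ℕ) (T : Multiset (ℕ × ℕ)), (∀ p ∈ T, p.2 ≤ a) → Std q T →
    ∃ s : ℕ → ℕ, s 0 = q ∧ Monotone s ∧ ∀ k, (T.map fun p => K p.1 p.2 k).sum =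
      ∑ i ∈ Finset.range (a + 1), ∑ j ∈ Finset.Ico (s i) (s (i + 1)), K j (a - i) k := by
  intro a
  induction a with
  | zero =>
    intro q T hT _
    refine ⟨fun i => if i = 0 then q else q + T.card, by simp, ?_, ?_⟩
    · intro i j hij
      by_cases hi : i = 0 <;> by_cases hj : j = 0 <;> simp [hi, hj] <;> omega
    · intro k
      have : T.map (fun p => K p.1 p.2 k) = T.map (fun _ => K 0 0 k) := by
        apply Multiset.map_congr rfl
        intro p hp
        have := hT p hp
        rw [show p.2 = 0 by omega]
        exact K_zero _ _ _
      rw [this]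
      simp only [zero_add, Finset.range_one, Finset.sum_singleton, Nat.sub_self]
      rw [Finset.sum_congr rfl (fun j _ => K_zero j 0 k)]
      simp
  | succ a ih =>
    intro q T hT hstd
    classical
    let T1 := T.filter (fun p => p.2 = a + 1)
    let T0 := T.filter (fun p => ¬ p.2 = a + 1)
    have hsplit : T1 + T0 = T := Multiset.filter_add_not _ _
    obtain ⟨h1, C, h2, h3⟩ := push a T1.card (T1.map Prod.fst) q (by simp) (by
      intro b hb j hj1 hj2
      rw [Multiset.mem_map] at hb
      obtain ⟨p, hp, rfl⟩ := hb
      rw [Multiset.mem_filter] at hp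
      obtain ⟨p', hp', e1, e2⟩ := hstd p hp.1 j hj1 hj2
      rw [Multiset.mem_map]
      refine ⟨p', Multiset.mem_filter.2 ⟨hp', ?_⟩, e1⟩
      have := hT p' hp'
      omega)
    obtain ⟨s, s0, smono, hs⟩ := ih (q + T1.card) (T0 + C.map (fun c => (c, a))) (by
      intro p hp
      rw [Multiset.mem_add] at hp
      rcases hp with hp | hp
      · rw [Multiset.mem_filter] at hp
        have := hT p hp.1
        omega
      · rw [Multiset.mem_map] at hp
        obtain ⟨c, _, rfl⟩ := hp
        exact le_rfl) (by
      intro p hp j hj1 hj2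
      rw [Multiset.mem_add] at hp
      rcases hp with hp | hp
      · rw [Multiset.mem_filter] at hp
        obtain ⟨p', hp', e1, e2⟩ := hstd p hp.1 j (by omega) hj2
        refine ⟨p', Multiset.mem_add.2 (Or.inl (Multiset.mem_filter.2 ⟨hp', ?_⟩)), e1, e2⟩
        intro h
        have := h1 p'.1 (Multiset.mem_map.2 ⟨p', Multiset.mem_filter.2 ⟨hp', h⟩, rfl⟩)
        omega
      · rw [Multiset.mem_map] at hp
        obtain ⟨c, hc, rfl⟩ := hp
        have := h2 c hc
        simp only at hj2
        omega)
    refine ⟨fun i => if i = 0 then q else s (i - 1), by simp, ?_, ?_⟩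
    · apply monotone_nat_of_le_succ
      intro i
      by_cases hi : i = 0
      · subst hi; simp [s0]
      · simp only [hi, if_false, Nat.succ_ne_zero]
        exact smono (by omega)
    · intro k
      rw [← hsplit, Multiset.map_add, Multiset.sum_add]
      have e1 : (T1.map fun p => K p.1 p.2 k).sum =
          ((T1.map Prod.fst).map fun b => K b (a + 1) k).sum := by
        rw [Multiset.map_map]
        congr 1
        apply Multiset.map_congr rfl
        intro p hp
        rw [Multiset.mem_filter] at hp
        simp [hp.2]
      have e2 := hs k
      rw [Multiset.map_add, Multiset.sum_add, Multiset.map_map] at e2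
      simp only [Function.comp_def] at e2
      rw [e1, h3 k, Finset.sum_range_succ' _ (a + 1)]
      simp only [Nat.succ_ne_zero, if_false, if_true, Nat.add_sub_cancel, Nat.sub_zero, zero_add,
        Nat.sub_self, s0, Nat.add_sub_add_right]
      rw [← e2]; ring

theorem hockey (l s : ℕ) : ∑ j ∈ Finset.range s, ((j.choose l : ℕ) : ℤ) = ((s.choose (l + 1) : ℕ) : ℤ) := by
  induction s with
  | zero => simp
  | succ s ih => rw [Finset.sum_range_succ, ih, Nat.choose_succ_succ]; push_cast; ring

/-- The Gotzmann form of the coefficients. -/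
theorem coeffs (d : ℕ) (T : Multiset (ℕ × ℕ)) (hstd : Std 0 T) (c : ℕ) (e : ℕ → ℤ) (L : ℕ → ℕ)
    (hL : ∀ n, L n = c + (T.map (cone n)).sum) (N0 : ℕ)
    (he : ∀ n ≥ N0, (L n : ℤ) =
      ∑ i ∈ Finset.range (d + 1), (-1) ^ i * e i * ((n + d - i).choose (d - i) : ℤ)) :
    ∃ s : ℕ → ℕ, s 0 = 0 ∧ Monotone s ∧ ∀ q ≤ d, (-1) ^ q * e q = (if q = d then (c : ℤ) else 0) +
      ∑ i ∈ Finset.range (q + 1), (-1) ^ (q - i) *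
        (((s (i + 1)).choose (q - i + 1) : ℤ) - ((s i).choose (q - i + 1) : ℤ)) := by
  -- bounds for T
  obtain ⟨N, hN⟩ : ∃ N, ∀ p ∈ T, p.1 ≤ N ∧ p.2 ≤ N := by
    refine ⟨(T.map fun p => p.1 + p.2).sum, fun p hp => ?_⟩
    have : p.1 + p.2 ≤ (T.map fun p => p.1 + p.2).sum :=
      Multiset.single_le_sum (fun x _ => Nat.zero_le x) _
        (Multiset.mem_map_of_mem (fun p : ℕ × ℕ => p.1 + p.2) hp)
    omega
  let M := N + d + 1
  let E : ℕ → ℤ := fun k => if k ≤ d then (-1) ^ (d - k) * e (d - k) else 0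
  have hEsum : ∀ n, ∑ i ∈ Finset.range (d + 1), (-1) ^ i * e i * ((n + d - i).choose (d - i) : ℤ) =
      ∑ k ∈ Finset.range M, E k * (((n + k).choose k : ℕ) : ℤ) := by
    intro n
    have hsub : Finset.range (d + 1) ⊆ Finset.range M := by
      intro i hi
      simp only [Finset.mem_range, M] at hi ⊢
      omega
    rw [← Finset.sum_subset hsub]
    · rw [← Finset.sum_range_reflect]
      refine Finset.sum_congr rfl fun i hi => ?_
      rw [Finset.mem_range] at hi
      simp only [E]
      rw [if_pos (by omega), show d + 1 - 1 - i = d - i by omega, show d - (d - i) = i by omega,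
        show n + d - (d - i) = n + i by omega]
    · intro i _ hi
      rw [Finset.mem_range] at hi
      simp only [E]
      rw [if_neg (by omega)]; simp
  have hcone : ∀ n ≥ N, (((T.map (cone n)).sum : ℕ) : ℤ) =
      ∑ k ∈ Finset.range M, (T.map fun p => K p.1 p.2 k).sum * (((n + k).choose k : ℕ) : ℤ) := by
    intro n hn
    have h1 : (((T.map (cone n)).sum : ℕ) : ℤ) = (T.map fun p => ∑ k ∈ Finset.range M, K p.1 p.2 k * (((n + k).choose k : ℕ) : ℤ)).sum := by
      rw [Nat.cast_multiset_sum, Multiset.map_map]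
      congr 1
      apply Multiset.map_congr rfl
      intro p hp
      have hp' := hN p hp
      rw [← cone_eq M p.1 p.2 n (by omega) (by simp only [M]; omega)]
      simp [cone, show p.1 ≤ n by omega]
    rw [h1, Multiset.sum_map_sum]
    refine Finset.sum_congr rfl fun k _ => ?_
    rw [Multiset.sum_map_mul_right]
  have hcoef : ∀ k < M, E k - (if k = 0 then (c : ℤ) else 0) - (T.map fun p => K p.1 p.2 k).sum = 0 := by
    apply basis_unique M _ (max N N0)
    intro n hn
    have h1 := he n (le_of_max_le_right hn)
    rw [hEsum, hL n] at h1
    rw [Nat.cast_add] at h1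
    have h2 := hcone n (le_of_max_le_left hn)
    have h3 : ∑ k ∈ Finset.range M, (if k = 0 then (c : ℤ) else 0) * (((n + k).choose k : ℕ) : ℤ) = c := by
      rw [Finset.sum_eq_single 0]
      · simp
      · intro b _ hb; simp [hb]
      · intro h; simp [M] at h
    simp only [sub_mul, Finset.sum_sub_distrib]
    rw [h3, ← h2, ← h1]
    ring
  have hdim : ∀ p ∈ T, p.2 ≤ d := by
    by_contra hcon
    push Not at hcon
    obtain ⟨p0, hp0, hlt⟩ := hcon
    classical
    obtain ⟨p, hp, hmax⟩ := Finset.exists_max_image T.toFinset Prod.snd ⟨p0, by simpa using hp0⟩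
    rw [Multiset.mem_toFinset] at hp
    have hmax' : ∀ p' ∈ T, p'.2 ≤ p.2 := fun p' h => hmax p' (by simpa using h)
    have hpd : d < p.2 := lt_of_lt_of_le hlt (hmax' p0 hp0)
    have h1 := hcoef p.2 (by have := hN p hp; simp only [M]; omega)
    simp only [E] at h1
    rw [if_neg (by omega), if_neg (by omega)] at h1
    have hnn : ∀ x ∈ (T.map fun p' => K p'.1 p'.2 p.2), 0 ≤ x := by
      intro x hx
      rw [Multiset.mem_map] at hx
      obtain ⟨p', hp', rfl⟩ := hx
      have := hmax' p' hp'
      unfold K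
      split_ifs with h
      · rw [show p'.2 - p.2 = 0 by omega]; simp
      · exact le_rfl
    have h2 := Multiset.single_le_sum hnn _ (Multiset.mem_map_of_mem (fun p' : ℕ × ℕ => K p'.1 p'.2 p.2) hp)
    have h3 : K p.1 p.2 p.2 = 1 := by simp [K]
    simp only [h3] at h2
    linarith
  obtain ⟨s, s0, smono, hs⟩ := gotzmann d 0 T hdim hstd
  refine ⟨s, s0, smono, fun q hq => ?_⟩
  have h1 := hcoef (d - q) (by simp only [M]; omega)
  simp only [E] at h1
  rw [if_pos (by omega), show d - (d - q) = q by omega, hs] at h1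
  have h2 : (if d - q = 0 then (c : ℤ) else 0) = if q = d then (c : ℤ) else 0 := by
    congr 1
    rw [eq_iff_iff]; omega
  rw [h2] at h1
  have hsub : Finset.range (q + 1) ⊆ Finset.range (d + 1) := by
    intro i hi
    simp only [Finset.mem_range] at hi ⊢
    omega
  have h3 : ∑ i ∈ Finset.range (d + 1), ∑ j ∈ Finset.Ico (s i) (s (i + 1)), K j (d - i) (d - q) =
      ∑ i ∈ Finset.range (q + 1), (-1) ^ (q - i) *
        (((s (i + 1)).choose (q - i + 1) : ℤ) - ((s i).choose (q - i + 1) : ℤ)) := by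
    rw [← Finset.sum_subset hsub]
    · refine Finset.sum_congr rfl fun i hi => ?_
      rw [Finset.mem_range] at hi
      rw [← hockey, ← hockey, ← Finset.sum_Ico_eq_sub _ (smono (Nat.le_succ i)), Finset.mul_sum]
      refine Finset.sum_congr rfl fun j _ => ?_
      unfold K
      rw [if_pos (by omega), show d - i - (d - q) = q - i by omega]
    · intro i hi1 hi2
      rw [Finset.mem_range] at hi1 hi2
      apply Finset.sum_eq_zero
      intro j _
      unfold K
      rw [if_neg (by omega)]
  rw [h3] at h1
  linarith

end HB

namespace HB

/-- The main term of the Gotzmann form. -/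
def R (s : ℕ → ℕ) (q : ℕ) : ℤ := ∑ j ∈ Finset.range q, (-1) ^ j *
  (((s (q - j)).choose (j + 2) : ℤ) - ((s (q - 1 - j)).choose (j + 2) : ℤ))

theorem fact_bound (k : ℕ) : 24 * 4 ^ k ≤ (k + 4).factorial := by
  induction k with
  | zero => decide
  | succ k ih =>
    rw [show k + 1 + 4 = (k + 4) + 1 by omega, Nat.factorial_succ, pow_succ]
    nlinarith [Nat.zero_le (k * (k + 4).factorial)]

theorem two_pow_bound (k : ℕ) : k + 4 ≤ 2 ^ (k + 2) := by
  induction k with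
  | zero => decide
  | succ k ih => rw [show k + 1 + 2 = (k + 2) + 1 by omega, pow_succ]; omega

theorem R_term (s : ℕ → ℕ) (q : ℕ) (y : ℚ) (hy : 1 ≤ y) (k : ℕ) (hk : k + 2 < q)
    (hS : ∀ i < q, (s (i + 1) : ℚ) ≤ y ^ (2 ^ i)) :
    ((s (q - (k + 2))).choose (k + 2 + 2) : ℚ) ≤ y ^ (2 ^ (q - 1)) / 24 * (1 / 4) ^ k := by
  have h1 : ((s (q - (k + 2))).choose (k + 4) : ℚ) ≤ (s (q - (k + 2)) : ℚ) ^ (k + 4) / ((k + 4).factorial : ℚ) :=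
    Nat.choose_le_pow_div _ _
  have h2 : (s (q - (k + 2)) : ℚ) ≤ y ^ (2 ^ (q - 1 - (k + 2))) := by
    have := hS (q - 1 - (k + 2)) (by omega)
    rwa [show q - 1 - (k + 2) + 1 = q - (k + 2) by omega] at this
  have h3 : (s (q - (k + 2)) : ℚ) ^ (k + 4) ≤ y ^ (2 ^ (q - 1)) := by
    calc (s (q - (k + 2)) : ℚ) ^ (k + 4) ≤ (y ^ (2 ^ (q - 1 - (k + 2)))) ^ (k + 4) :=
          pow_le_pow_left₀ (Nat.cast_nonneg _) h2 _
      _ = y ^ (2 ^ (q - 1 - (k + 2)) * (k + 4)) := (pow_mul _ _ _).symm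
      _ ≤ y ^ (2 ^ (q - 1)) := by
          apply pow_le_pow_right₀ hy
          calc 2 ^ (q - 1 - (k + 2)) * (k + 4) ≤ 2 ^ (q - 1 - (k + 2)) * 2 ^ (k + 2) :=
                Nat.mul_le_mul_left _ (two_pow_bound k)
            _ = 2 ^ (q - 1) := by rw [← pow_add]; congr 1; omega
  have h4 : (24 * 4 ^ k : ℚ) ≤ ((k + 4).factorial : ℚ) := by exact_mod_cast fact_bound k
  have h5 : (0 : ℚ) < 24 * 4 ^ k := by positivity
  have h0 : (0 : ℚ) ≤ y ^ (2 ^ (q - 1)) := by positivity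
  calc ((s (q - (k + 2))).choose (k + 2 + 2) : ℚ) ≤ _ := h1
    _ ≤ y ^ (2 ^ (q - 1)) / (24 * 4 ^ k) := by gcongr
    _ = _ := by field_simp; rw [← mul_pow]; norm_num

theorem R_bound (s : ℕ → ℕ) (smono : Monotone s) (q : ℕ) (hq : 2 ≤ q) (y : ℚ) (hy : 1 ≤ y)
    (hS : ∀ i < q, (s (i + 1) : ℚ) ≤ y ^ (2 ^ i)) :
    (R s q : ℚ) ≤ (y ^ (2 ^ (q - 1))) ^ 2 / 2 + y ^ (2 ^ (q - 1)) / 18 := by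
  set z := y ^ (2 ^ (q - 1)) with hz
  have hz0 : 0 ≤ z := by positivity
  let t : ℕ → ℚ := fun j => (-1) ^ j *
    (((s (q - j)).choose (j + 2) : ℚ) - ((s (q - 1 - j)).choose (j + 2) : ℚ))
  have hR : (R s q : ℚ) = ∑ j ∈ Finset.range q, t j := by
    simp [R, t]
  have hmono : ∀ j, ((s (q - 1 - j)).choose (j + 2) : ℚ) ≤ ((s (q - j)).choose (j + 2) : ℚ) := by
    intro j
    exact_mod_cast Nat.choose_le_choose _ (smono (by omega))
  have h0 : t 0 ≤ z ^ 2 / 2 := by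
    have h1 : ((s q).choose 2 : ℚ) ≤ (s q : ℚ) ^ 2 / ((2).factorial : ℚ) := Nat.choose_le_pow_div _ _
    have h2 : (s q : ℚ) ≤ z := by
      have := hS (q - 1) (by omega)
      rwa [show q - 1 + 1 = q by omega] at this
    have h3 : (s q : ℚ) ^ 2 ≤ z ^ 2 := pow_le_pow_left₀ (Nat.cast_nonneg _) h2 _
    have h4 : ((2).factorial : ℚ) = 2 := by norm_num [Nat.factorial]
    rw [h4] at h1
    have h5 : (0 : ℚ) ≤ ((s (q - 1)).choose 2 : ℚ) := Nat.cast_nonneg _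
    simp only [t, pow_zero, one_mul, Nat.sub_zero, zero_add]
    linarith
  have h1 : t 1 ≤ 0 := by
    have := hmono 1
    simp only [t, pow_one]
    linarith
  have key : ∀ k, k + 2 ≤ q → ∑ j ∈ Finset.range (k + 2), t j ≤ z ^ 2 / 2 + z / 18 * (1 - (1 / 4) ^ k) := by
    intro k
    induction k with
    | zero =>
      intro _
      simp only [zero_add, Finset.sum_range_succ, Finset.sum_range_zero, pow_zero]
      linarith
    | succ k ih =>
      intro hk
      rw [show k + 1 + 2 = (k + 2) + 1 by omega, Finset.sum_range_succ]
      have h2 := ih (by omega)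
      have h3 := R_term s q y hy k (by omega) hS
      rw [← hz] at h3
      have h4 := hmono (k + 2)
      have h5 : (0 : ℚ) ≤ ((s (q - 1 - (k + 2))).choose (k + 2 + 2) : ℚ) := Nat.cast_nonneg _
      have h6 : t (k + 2) ≤ z / 24 * (1 / 4) ^ k := by
        simp only [t]
        rcases neg_one_pow_eq_or ℚ (k + 2) with h | h <;> rw [h]
        · linarith
        · have : 0 ≤ z / 24 * (1 / 4) ^ k := by positivity
          linarith
      rw [pow_succ (1 / 4 : ℚ) k]
      linarith
  obtain ⟨k, rfl⟩ := Nat.exists_eq_add_of_le' hq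
  have := key k le_rfl
  rw [hR]
  have h7 : 0 ≤ z / 18 * (1 / 4) ^ k := by positivity
  linarith

theorem sq_two_pow (y : ℚ) (q : ℕ) (hq : 1 ≤ q) : y ^ (2 ^ q) = (y ^ (2 ^ (q - 1))) ^ 2 := by
  rw [← pow_mul, ← pow_succ]
  congr 2
  omega

theorem sq_le_z (y : ℚ) (hy : 1 ≤ y) (q : ℕ) (hq : 2 ≤ q) : y ^ 2 ≤ y ^ (2 ^ (q - 1)) := by
  apply pow_le_pow_right₀ hy
  calc 2 = 2 ^ 1 := by norm_num
    _ ≤ 2 ^ (q - 1) := Nat.pow_le_pow_right (by norm_num) (by omega)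

theorem R_final (s : ℕ → ℕ) (s0 : s 0 = 0) (smono : Monotone s) (q : ℕ) (hq : 1 ≤ q) (x : ℕ)
    (hS : ∀ i < q, (s (i + 1) : ℚ) ≤ ((x : ℚ) + 1) ^ (2 ^ i) - 1) :
    (R s q : ℚ) + s 1 < 7 / 12 * ((x : ℚ) + 1) ^ (2 ^ q) := by
  have hx : (0 : ℚ) ≤ x := Nat.cast_nonneg _
  have hs1 : (s 1 : ℚ) ≤ x := by
    have := hS 0 (by omega)
    simpa using this
  rcases Nat.lt_or_ge q 2 with h | h
  · have : q = 1 := by omega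
    subst this
    have hR : (R s 1 : ℚ) = (s 1 : ℚ) * ((s 1 : ℚ) - 1) / 2 := by
      simp [R, s0, Nat.cast_choose_two]
    rw [hR]
    have h0 : (0 : ℚ) ≤ s 1 := Nat.cast_nonneg _
    norm_num
    nlinarith
  · have hy : (1 : ℚ) ≤ (x : ℚ) + 1 := by linarith
    have h1 := R_bound s smono q h ((x : ℚ) + 1) hy (fun i hi => (hS i hi).trans (by linarith))
    have h2 := sq_le_z ((x : ℚ) + 1) hy q h
    rw [sq_two_pow _ q hq]
    set z := ((x : ℚ) + 1) ^ (2 ^ (q - 1))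
    -- z^2/12 - z/18 > x
    have h3 : z ^ 2 / 12 - z / 18 > x := by
      have hz1 : 1 ≤ z := by nlinarith
      rcases Nat.eq_zero_or_pos x with h | h
      · rw [h]; push_cast; nlinarith
      · have hx1 : (1 : ℚ) ≤ x := by exact_mod_cast h
        have hz4 : 4 * (x : ℚ) ≤ z := by nlinarith [sq_nonneg ((x : ℚ) - 1)]
        have : (4 : ℚ) ≤ z := by linarith
        nlinarith
    linarith

/-- Numerical core. -/
theorem numeric (d : ℕ) (hd : 1 ≤ d) (c : ℕ) (e : ℕ → ℤ) (s : ℕ → ℕ) (s0 : s 0 = 0)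
    (smono : Monotone s)
    (hc : ∀ q ≤ d, (-1) ^ q * e q = (if q = d then (c : ℤ) else 0) +
      ∑ i ∈ Finset.range (q + 1), (-1) ^ (q - i) *
        (((s (i + 1)).choose (q - i + 1) : ℤ) - ((s i).choose (q - i + 1) : ℤ)))
    (X : ℕ → ℕ) (hX : Monotone X) (hXe : ∀ q, ∀ k ≤ q, k < d → |e k| ≤ X q) :
    ∀ q, 1 ≤ q → q ≤ d → ((-1) ^ (q - 1) * e q : ℚ) < 7 / 12 * ((X (q - 1) : ℚ) + 1) ^ (2 ^ q) - e 0 := by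
  have hform : ∀ q, 1 ≤ q → q ≤ d →
      (-1) ^ q * e q = (if q = d then (c : ℤ) else 0) + ((s (q + 1) : ℤ) - s q) - R s q := by
    intro q hq hqd
    rw [hc q hqd, Finset.sum_range_succ]
    have : ∑ i ∈ Finset.range q, (-1) ^ (q - i) *
        (((s (i + 1)).choose (q - i + 1) : ℤ) - ((s i).choose (q - i + 1) : ℤ)) = - R s q := by
      rw [R, ← Finset.sum_range_reflect, ← Finset.sum_neg_distrib]
      refine Finset.sum_congr rfl fun i hi => ?_
      rw [Finset.mem_range] at hi
      rw [show q - (q - 1 - i) = i + 1 by omega, show q - 1 - i + 1 = q - i by omega, pow_succ]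
      ring
    rw [this]
    simp
    ring
  have he0 : e 0 = s 1 := by
    have := hc 0 (Nat.zero_le _)
    rw [if_neg (by omega)] at this
    simpa [s0] using this
  have hS : ∀ q, q < d → (s (q + 1) : ℚ) ≤ ((X q : ℚ) + 1) ^ (2 ^ q) - 1 := by
    intro q
    induction q using Nat.strong_induction_on with
    | _ q ih =>
    intro hqd
    have hx : (0 : ℚ) ≤ X q := Nat.cast_nonneg _
    rcases Nat.eq_zero_or_pos q with h | hq
    · subst h
      have := hXe 0 0 le_rfl hd
      rw [he0] at this
      have h2 : (s 1 : ℤ) ≤ X 0 := (le_abs_self _).trans this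
      have h3 : (s 1 : ℚ) ≤ X 0 := by exact_mod_cast h2
      simpa using h3
    have hSi : ∀ i < q, (s (i + 1) : ℚ) ≤ ((X q : ℚ) + 1) ^ (2 ^ i) - 1 := by
      intro i hi
      refine (ih i hi (by omega)).trans ?_
      have : (X i : ℚ) ≤ X q := by exact_mod_cast hX hi.le
      gcongr
    have hR := R_final s s0 smono q hq (X q) hSi
    have hf := hform q hq hqd.le
    rw [if_neg (by omega), zero_add] at hf
    have habs : (-1) ^ q * e q ≤ X q := by
      refine le_trans ?_ (hXe q q le_rfl hqd)
      refine (le_abs_self _).trans ?_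
      rw [abs_mul, abs_pow]; simp
    have hle : (s (q + 1) : ℤ) ≤ s q + R s q + X q := by linarith
    have hleq : (s (q + 1) : ℚ) ≤ s q + R s q + X q := by exact_mod_cast hle
    have hsq := hSi (q - 1) (by omega)
    rw [show q - 1 + 1 = q by omega] at hsq
    have hs10 : (0 : ℚ) ≤ s 1 := Nat.cast_nonneg _
    rcases Nat.eq_zero_or_pos (X q) with h | h
    · rw [h] at hR hsq hleq ⊢
      simp at hR hsq hleq ⊢
      have hR' : R s q ≤ 0 := by
        by_contra hcon
        have : (1 : ℚ) ≤ R s q := by exact_mod_cast (by omega : (1 : ℤ) ≤ R s q)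
        linarith
      have hR'' : (R s q : ℚ) ≤ 0 := by exact_mod_cast hR'
      have h5 : (s (q + 1) : ℚ) ≤ 0 := by
        rw [hsq] at hleq
        simp at hleq
        linarith
      have : s (q + 1) ≤ 0 := by exact_mod_cast h5
      omega
    · have hx1 : (1 : ℚ) ≤ X q := by exact_mod_cast h
      rcases Nat.lt_or_ge q 2 with h2 | h2
      · have : q = 1 := by omega
        subst this
        have hR1 : (R s 1 : ℚ) = (s 1 : ℚ) * ((s 1 : ℚ) - 1) / 2 := by
          simp [R, s0, Nat.cast_choose_two]
        rw [hR1] at hleq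
        have hsq' : (s 1 : ℚ) ≤ X 1 := by simpa using hsq
        have hprod : (s 1 : ℚ) * s 1 ≤ X 1 * X 1 := mul_le_mul hsq' hsq' hs10 hx
        have e1 : ((X 1 : ℚ) + 1) ^ (2 ^ 1) = X 1 * X 1 + 2 * X 1 + 1 := by norm_num; ring
        rw [e1]
        nlinarith
      · rw [sq_two_pow _ q hq] at hR ⊢
        have hz := sq_le_z ((X q : ℚ) + 1) (by linarith) q h2
        set z := ((X q : ℚ) + 1) ^ (2 ^ (q - 1))
        have hz4 : 4 * (X q : ℚ) ≤ z := by nlinarith [sq_nonneg ((X q : ℚ) - 1)]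
        have : (4 : ℚ) ≤ z := by linarith
        nlinarith
  intro q hq hqd
  have hSi : ∀ i < q, (s (i + 1) : ℚ) ≤ ((X (q - 1) : ℚ) + 1) ^ (2 ^ i) - 1 := by
    intro i hi
    refine (hS i (by omega)).trans ?_
    have : (X i : ℚ) ≤ X (q - 1) := by exact_mod_cast hX (by omega)
    gcongr
  have hR := R_final s s0 smono q hq (X (q - 1)) hSi
  have hf := hform q hq hqd
  have hcnn : (0 : ℤ) ≤ if q = d then (c : ℤ) else 0 := by split_ifs <;> simp
  have hss : (s q : ℤ) ≤ s (q + 1) := by exact_mod_cast smono (Nat.le_succ q)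
  have hle : (-1) ^ (q - 1) * e q ≤ R s q := by
    have : (-1 : ℤ) ^ q = - (-1) ^ (q - 1) := by
      conv_lhs => rw [show q = q - 1 + 1 by omega]
      rw [pow_succ]; ring
    rw [this] at hf
    linarith
  have hleq : ((-1) ^ (q - 1) * e q : ℚ) ≤ R s q := by exact_mod_cast hle
  rw [he0]
  push_cast
  linarith

end HB

namespace HB

open IsLocalRing

variable {A : Type*} [CommRing A]

theorem sup_span_mem {S S' : Set A} (J : Ideal A) (h : S ⊆ S') {x : A}
    (hx : x ∈ Ideal.span S ⊔ J) : x ∈ Ideal.span S' ⊔ J :=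
  (sup_le_sup_right (Ideal.span_mono h) J : Ideal.span S ⊔ J ≤ Ideal.span S' ⊔ J) hx

/-- ideals generated modulo `I^2` by a good sequence -/
def Good (𝔪 I N : Ideal A) : Prop := ∃ (r : ℕ) (z : Fin r → A), (∀ i, z i ∈ I) ∧
    N = Ideal.span (Set.range z) ⊔ I ^ 2 ∧
      ∀ i, ∀ a ∈ 𝔪, a * z i ∈ Ideal.span {w | ∃ j, i < j ∧ w = z j} ⊔ I ^ 2

theorem good_zero (𝔪 I : Ideal A) : Good 𝔪 I (Ideal.span (Set.range (Fin.elim0 : Fin 0 → A)) ⊔ I ^ 2) :=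
  ⟨0, Fin.elim0, fun i => i.elim0, rfl, fun i => i.elim0⟩

theorem good_cons (𝔪 I N : Ideal A) (hN : Good 𝔪 I N) (w : A) (hwN : w ∉ N) (hwI : w ∈ I)
    (haw : ∀ a ∈ 𝔪, a * w ∈ N) : ∃ N', Good 𝔪 I N' ∧ N < N' := by
  obtain ⟨r, z, hz, hN, hm⟩ := hN
  refine ⟨Ideal.span (Set.range (Fin.cons w z : Fin (r + 1) → A)) ⊔ I ^ 2,
    ⟨r + 1, Fin.cons w z, ?_, rfl, ?_⟩, ?_⟩
  · intro i
    refine Fin.cases ?_ (fun i => ?_) i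
    · simpa using hwI
    · simpa using hz i
  · intro i
    refine Fin.cases ?_ (fun i => ?_) i
    · intro a ha
      have h1 := haw a ha
      rw [hN] at h1
      rw [Fin.cons_zero]
      refine sup_span_mem _ ?_ h1
      rintro _ ⟨i, rfl⟩
      exact ⟨i.succ, Fin.succ_pos i, by simp⟩
    · intro a ha
      rw [Fin.cons_succ]
      refine sup_span_mem _ ?_ (hm i a ha)
      rintro _ ⟨j, hj, rfl⟩
      exact ⟨j.succ, Fin.succ_lt_succ_iff.2 hj, by simp⟩
  · refine lt_of_le_of_ne ?_ ?_
    · rw [hN]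
      refine sup_le_sup_right (Ideal.span_mono ?_) _
      rintro _ ⟨i, rfl⟩
      exact ⟨i.succ, by simp⟩
    · intro h
      apply hwN
      rw [h]
      exact Ideal.mem_sup_left (Ideal.subset_span ⟨0, by simp⟩)

theorem exists_gens [IsNoetherianRing A] (𝔪 I : Ideal A) (k : ℕ) (hk : 𝔪 ^ k ≤ I) :
    ∃ (r : ℕ) (z : Fin r → A), (∀ i, z i ∈ I) ∧ I ≤ Ideal.span (Set.range z) ⊔ I ^ 2 ∧
      ∀ i, ∀ a ∈ 𝔪, a * z i ∈ Ideal.span {w | ∃ j, i < j ∧ w = z j} ⊔ I ^ 2 := by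
  obtain ⟨N, hG, hmax⟩ := set_has_maximal_iff_noetherian.2 ‹IsNoetherianRing A› {N | Good 𝔪 I N}
    ⟨_, good_zero 𝔪 I⟩
  by_cases hIN : I ≤ N
  · obtain ⟨r, z, hz, hN, hm⟩ := hG
    exact ⟨r, z, hz, hN ▸ hIN, hm⟩
  exfalso
  have hex : 𝔪 ^ k * I ≤ N := by
    obtain ⟨r, z, hz, hN, hm⟩ := hG
    rw [hN]
    refine le_trans ?_ le_sup_right
    rw [pow_two]
    exact Ideal.mul_mono_left hk
  have key : ∀ j : ℕ, 𝔪 ^ j * I ≤ N → False := by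
    intro j
    induction j with
    | zero =>
      intro h
      rw [pow_zero, one_mul] at h
      exact hIN h
    | succ j ih =>
      intro hj
      obtain ⟨w, hw, hwN⟩ := SetLike.not_le_iff_exists.1 ih
      have hle : 𝔪 ^ j * I ≤ I := Ideal.mul_le_right
      have hwI : w ∈ I := hle hw
      rw [pow_succ', mul_assoc] at hj
      obtain ⟨N', hN', hlt⟩ := good_cons 𝔪 I N hG w hwN hwI
        (fun a ha => hj (Ideal.mul_mem_mul ha hw))
      exact hmax N' hN' hlt
  exact key k hex

theorem length_step [IsLocalRing A] (J : Ideal A) (w : A) (hw : w ∉ J)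
    (hm : ∀ a ∈ maximalIdeal A, a * w ∈ J) :
    Module.length A (A ⧸ J) = Module.length A (A ⧸ (J ⊔ Ideal.span {w})) + 1 := by
  let f : (A ⧸ maximalIdeal A) →ₗ[A] (A ⧸ J) :=
    Submodule.liftQ (maximalIdeal A) (LinearMap.toSpanSingleton A (A ⧸ J) (Submodule.Quotient.mk w))
      (by
        intro a ha
        rw [LinearMap.mem_ker, LinearMap.toSpanSingleton_apply, ← Submodule.Quotient.mk_smul,
          Submodule.Quotient.mk_eq_zero]
        exact hm a ha)
  have hf : ∀ a : A, f (Submodule.Quotient.mk a) = Submodule.Quotient.mk (a * w) := by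
    intro a
    rfl
  let g : (A ⧸ J) →ₗ[A] (A ⧸ (J ⊔ Ideal.span {w})) :=
    Submodule.mapQ J (J ⊔ Ideal.span {w}) LinearMap.id (fun x hx => (le_sup_left : J ≤ _) hx)
  have hg : ∀ a : A, g (Submodule.Quotient.mk a) = Submodule.Quotient.mk a := fun a => rfl
  have hfi : Function.Injective f := by
    rw [injective_iff_map_eq_zero]
    intro x hx
    obtain ⟨a, rfl⟩ := Submodule.Quotient.mk_surjective _ x
    rw [hf, Submodule.Quotient.mk_eq_zero] at hx
    rw [Submodule.Quotient.mk_eq_zero]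
    by_contra hcon
    have hu : IsUnit a := by
      by_contra h
      exact hcon ((mem_maximalIdeal a).2 h)
    exact hw ((Ideal.unit_mul_mem_iff_mem J hu).1 hx)
  have hgs : Function.Surjective g := by
    intro x
    obtain ⟨a, rfl⟩ := Submodule.Quotient.mk_surjective _ x
    exact ⟨Submodule.Quotient.mk a, rfl⟩
  have hex : Function.Exact f g := by
    intro x
    obtain ⟨a, rfl⟩ := Submodule.Quotient.mk_surjective _ x
    rw [hg, Submodule.Quotient.mk_eq_zero]
    constructor
    · intro h
      obtain ⟨j, hj, y, hy, rfl⟩ := Submodule.mem_sup.1 h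
      obtain ⟨b, rfl⟩ := Ideal.mem_span_singleton'.1 hy
      refine ⟨Submodule.Quotient.mk b, ?_⟩
      rw [hf, eq_comm, Submodule.Quotient.eq]
      simpa using hj
    · rintro ⟨y, hy⟩
      obtain ⟨b, rfl⟩ := Submodule.Quotient.mk_surjective _ y
      rw [hf, Submodule.Quotient.eq] at hy
      have h1 : b * w ∈ J ⊔ Ideal.span {w} :=
        (le_sup_right : _ ≤ J ⊔ Ideal.span {w}) (Ideal.mem_span_singleton'.2 ⟨b, rfl⟩)
      have h2 : b * w - a ∈ J ⊔ Ideal.span {w} := (le_sup_left : J ≤ _) hy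
      have := sub_mem h1 h2
      simpa using this
  have h1 : Module.length A (A ⧸ maximalIdeal A) = 1 := by
    rw [Module.length_eq_one_iff, isSimpleModule_iff_isCoatom]
    exact Ideal.isMaximal_def.1 (maximalIdeal.isMaximal A)
  rw [Module.length_eq_add_of_exact f g hfi hgs hex, h1, add_comm]

variable {r : ℕ}

/-- monomials -/
def mon (z : Fin r → A) (α : Fin r → ℕ) : A := ∏ i, z i ^ α i

theorem mon_add (z : Fin r → A) (α β : Fin r → ℕ) : mon z (α + β) = mon z α * mon z β := by
  simp [mon, pow_add, Finset.prod_mul_distrib]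

theorem mon_single (z : Fin r → A) (i : Fin r) : mon z (Pi.single i 1) = z i := by
  rw [mon, Finset.prod_eq_single i]
  · simp
  · intro j _ hj; simp [hj]
  · simp

theorem mon_zero (z : Fin r → A) : mon z 0 = 1 := by simp [mon]

theorem mon_mem (I : Ideal A) (z : Fin r → A) (hz : ∀ i, z i ∈ I) (α : Fin r → ℕ) :
    mon z α ∈ I ^ (∑ i, α i) := by
  rw [← Finset.prod_pow_eq_pow_sum]
  exact Ideal.prod_mem_prod fun i _ => Ideal.pow_mem_pow (hz i) _

/-- span of some monomials of degree `n`, modulo `I^(n+1)` -/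
def W (I : Ideal A) (z : Fin r → A) (n : ℕ) (P : (Fin r → ℕ) → Prop) : Ideal A :=
  Ideal.span {w | ∃ β : Fin r → ℕ, ∑ i, β i = n ∧ P β ∧ w = mon z β} ⊔ I ^ (n + 1)

theorem W_mono (I : Ideal A) (z : Fin r → A) (n : ℕ) (P Q : (Fin r → ℕ) → Prop)
    (h : ∀ β, ∑ i, β i = n → P β → Q β) : W I z n P ≤ W I z n Q := by
  refine sup_le_sup_right (Ideal.span_mono ?_) _
  rintro _ ⟨β, h1, h2, rfl⟩
  exact ⟨β, h1, h β h1 h2, rfl⟩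

theorem mon_mul_W (I : Ideal A) (z : Fin r → A) (hz : ∀ i, z i ∈ I) (n : ℕ)
    (P Q : (Fin r → ℕ) → Prop) (γ : Fin r → ℕ) (h : ∀ β, ∑ i, β i = n → P β → Q (γ + β))
    (x : A) (hx : x ∈ W I z n P) : mon z γ * x ∈ W I z (∑ i, γ i + n) Q := by
  obtain ⟨u, hu, v, hv, rfl⟩ := Submodule.mem_sup.1 hx
  clear hx
  rw [mul_add]
  refine add_mem ?_ ?_
  · refine (le_sup_left : _ ≤ W I z _ Q) ?_
    induction hu using Submodule.span_induction with
    | mem w hw =>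
      obtain ⟨β, h1, h2, rfl⟩ := hw
      rw [← mon_add]
      refine Ideal.subset_span ⟨γ + β, ?_, h β h1 h2, rfl⟩
      simp [Finset.sum_add_distrib, h1]
    | zero => simp
    | add a b _ _ ha hb =>
      rw [mul_add]
      exact add_mem ha hb
    | smul c a _ ha =>
      rw [smul_eq_mul, mul_left_comm]
      exact Ideal.mul_mem_left _ _ ha
  · refine (le_sup_right : _ ≤ W I z _ Q) ?_
    rw [add_assoc, pow_add]
    exact Ideal.mul_mem_mul (mon_mem I z hz γ) hv

theorem pow_le_W (I : Ideal A) (z : Fin r → A) (hz : ∀ i, z i ∈ I)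
    (hI : I ≤ Ideal.span (Set.range z) ⊔ I ^ 2) (n : ℕ) : I ^ n ≤ W I z n (fun _ => True) := by
  induction n with
  | zero =>
    have : (1 : A) ∈ W I z 0 (fun _ => True) :=
      (le_sup_left : _ ≤ W I z 0 _) (Ideal.subset_span ⟨0, by simp, trivial, (mon_zero z).symm⟩)
    rw [(Ideal.eq_top_iff_one _).2 this]
    exact le_top
  | succ n ih =>
    rw [pow_succ, Ideal.mul_le]
    intro x hx y hy
    obtain ⟨u, hu, v, hv, rfl⟩ := Submodule.mem_sup.1 (hI hy)
    rw [mul_add]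
    refine add_mem ?_ ?_
    · have hle : Ideal.span (Set.range z) ≤
          Submodule.comap (LinearMap.mulLeft A x) (W I z (n + 1) (fun _ => True)) := by
        rw [Ideal.span_le]
        rintro _ ⟨i, rfl⟩
        show x * z i ∈ W I z (n + 1) (fun _ => True)
        have := mon_mul_W I z hz n (fun _ => True) (fun _ => True) (Pi.single i 1)
          (fun _ _ _ => trivial) x (ih hx)
        rw [mon_single] at this
        simpa [mul_comm, add_comm] using this
      exact hle hu
    · refine (le_sup_right : _ ≤ W I z (n + 1) _) ?_
      rw [show n + 1 + 1 = n + 2 by omega, pow_add]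
      exact Ideal.mul_mem_mul hx hv

theorem W_le_pow (I : Ideal A) (z : Fin r → A) (hz : ∀ i, z i ∈ I) (n : ℕ)
    (P : (Fin r → ℕ) → Prop) : W I z n P ≤ I ^ n := by
  refine sup_le (Ideal.span_le.2 ?_) (Ideal.pow_le_pow_right (Nat.le_succ n))
  rintro _ ⟨β, rfl, _, rfl⟩
  exact mon_mem I z hz β

/-- standard monomials -/
def IsStd (I : Ideal A) (z : Fin r → A) (α : Fin r → ℕ) : Prop :=
  mon z α ∉ W I z (∑ i, α i) (fun β => toLex β < toLex α)

/-- The multicomplex of standard monomials. -/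
def stdSet (I : Ideal A) (z : Fin r → A) (hz : ∀ i, z i ∈ I) : LowerSet (Fin r → ℕ) where
  carrier := {α | IsStd I z α}
  lower' := by
    intro a b hba ha hb
    apply ha
    have hab : a = (a - b) + b := by
      funext i
      have : b i ≤ a i := hba i
      simp only [Pi.add_apply, Pi.sub_apply]
      omega
    have := mon_mul_W I z hz _ (fun β => toLex β < toLex b) (fun β => toLex β < toLex a) (a - b)
      (by
        intro β _ hβ
        conv_rhs => rw [hab]
        rw [toLex_add, toLex_add]
        exact add_lt_add_right hβ _) _ hb
    rw [← mon_add, ← hab] at this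
    have hs : ∑ i, a i = ∑ i, (a - b) i + ∑ i, b i := by
      conv_lhs => rw [hab]
      simp [Finset.sum_add_distrib]
    rw [hs]
    exact this

theorem max_mul_mon (𝔪 I : Ideal A) (z : Fin r → A) (hz : ∀ i, z i ∈ I)
    (hm : ∀ i, ∀ a ∈ 𝔪, a * z i ∈ Ideal.span {w | ∃ j, i < j ∧ w = z j} ⊔ I ^ 2)
    (α : Fin r → ℕ) (h0 : 1 ≤ ∑ i, α i) (a : A) (ha : a ∈ 𝔪) :
    a * mon z α ∈ W I z (∑ i, α i) (fun β => toLex β < toLex α) := by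
  have hex : ∃ i, α i ≠ 0 := by
    by_contra hcon
    push Not at hcon
    simp [hcon] at h0
  obtain ⟨i, hi⟩ := hex
  have hab : α = (α - Pi.single i 1) + Pi.single i 1 := by
    funext j
    by_cases hj : j = i
    · subst hj; simp; omega
    · simp [hj]
  set γ := α - Pi.single i 1 with hγ
  have h1 : a * z i ∈ W I z 1 (fun β => ∃ j, i < j ∧ β = Pi.single j 1) := by
    refine sup_span_mem _ ?_ (hm i a ha)
    rintro _ ⟨j, hj, rfl⟩
    exact ⟨Pi.single j 1, by simp, ⟨j, hj, rfl⟩, (mon_single z j).symm⟩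
  have h2 := mon_mul_W I z hz 1 _ (fun β => toLex β < toLex α) γ (by
    rintro β _ ⟨j, hj, rfl⟩
    rw [hab, toLex_add, toLex_add]
    refine add_lt_add_right ?_ _
    refine ⟨i, ?_, ?_⟩
    · intro k hk
      have hk1 : k ≠ i := hk.ne
      have hk2 : k ≠ j := (hk.trans hj).ne
      simp [hk1, hk2]
    · simp [hj.ne]) _ h1
  have hs : ∑ i, α i = ∑ i, γ i + 1 := by
    conv_lhs => rw [hab]
    simp [Finset.sum_add_distrib]
  rw [hs]
  have e : a * mon z α = mon z γ * (a * z i) := by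
    conv_lhs => rw [hab]
    rw [mon_add, mon_single]; ring
  rw [e]
  exact h2

theorem length_chain [IsLocalRing A] (I : Ideal A) (z : Fin r → A) (hz : ∀ i, z i ∈ I)
    (hm : ∀ i, ∀ a ∈ maximalIdeal A, a * z i ∈ Ideal.span {w | ∃ j, i < j ∧ w = z j} ⊔ I ^ 2)
    (n : ℕ) (hn : 1 ≤ n) (S : Finset (Lex (Fin r → ℕ))) :
    (∀ α ∈ S, ∑ i, (ofLex α) i = n) →
    (∀ α ∈ S, ∀ β : Lex (Fin r → ℕ), ∑ i, (ofLex β) i = n → β < α → β ∈ S) →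
    Module.length A (A ⧸ I ^ (n + 1)) = Module.length A (A ⧸ W I z n (fun β => toLex β ∈ S)) +
      (({α : Fin r → ℕ | toLex α ∈ S ∧ IsStd I z α}.ncard : ℕ) : ℕ∞) := by
  classical
  induction S using Finset.induction_on_max with
  | empty =>
    intro _ _
    have : W I z n (fun β => toLex β ∈ (∅ : Finset (Lex (Fin r → ℕ)))) = I ^ (n + 1) := by
      unfold W
      have : {w | ∃ β : Fin r → ℕ, ∑ i, β i = n ∧
        toLex β ∈ (∅ : Finset (Lex (Fin r → ℕ))) ∧ w = mon z β} = ∅ := by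
        ext; simp
      rw [this]; simp
    rw [this]; simp
  | insert a S hlt ih =>
    intro hdeg hcl
    have haS : a ∉ S := fun h => lt_irrefl _ (hlt a h)
    have ih' := ih (fun α h => hdeg α (Finset.mem_insert_of_mem h)) (by
      intro α hα β hβ hlt'
      have := hcl α (Finset.mem_insert_of_mem hα) β hβ hlt'
      rcases Finset.mem_insert.1 this with h | h
      · subst h
        exact absurd (hlt α hα) hlt'.not_gt
      · exact h)
    have hda : ∑ i, (ofLex a) i = n := hdeg a (Finset.mem_insert_self _ _)
    have hWeq : W I z n (fun β => toLex β ∈ S) = W I z n (fun β => toLex β < a) := by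
      apply le_antisymm
      · exact W_mono _ _ _ _ _ fun β _ h => hlt _ h
      · refine W_mono _ _ _ _ _ fun β hβ h => ?_
        rcases Finset.mem_insert.1 (hcl a (Finset.mem_insert_self _ _) (toLex β) hβ h) with h' | h'
        · exact absurd h (by rw [h']; exact lt_irrefl _)
        · exact h'
    have hWins : W I z n (fun β => toLex β ∈ insert a S) =
        W I z n (fun β => toLex β ∈ S) ⊔ Ideal.span {mon z (ofLex a)} := by
      apply le_antisymm
      · refine sup_le (Ideal.span_le.2 ?_) (le_sup_right.trans le_sup_left)
        rintro _ ⟨β, h1, h2, rfl⟩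
        rcases Finset.mem_insert.1 h2 with h | h
        · refine (le_sup_right : _ ≤ W I z n (fun β => toLex β ∈ S) ⊔ _) ?_
          rw [← h]
          exact Ideal.subset_span rfl
        · refine (le_sup_left : _ ≤ W I z n (fun β => toLex β ∈ S) ⊔ _) ?_
          exact (le_sup_left : _ ≤ W I z n _) (Ideal.subset_span ⟨β, h1, h, rfl⟩)
      · refine sup_le (W_mono _ _ _ _ _ fun β _ h => Finset.mem_insert_of_mem h) ?_
        rw [Ideal.span_le, Set.singleton_subset_iff]
        exact (le_sup_left : _ ≤ W I z n _)
          (Ideal.subset_span ⟨ofLex a, hda, Finset.mem_insert_self _ _, rfl⟩)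
    have hfin : {α : Fin r → ℕ | toLex α ∈ S ∧ IsStd I z α}.Finite :=
      (S.finite_toSet.preimage (toLex.injective.injOn)).subset fun α h => h.1
    by_cases hs : IsStd I z (ofLex a)
    · have hset : {α : Fin r → ℕ | toLex α ∈ insert a S ∧ IsStd I z α} =
          insert (ofLex a) {α : Fin r → ℕ | toLex α ∈ S ∧ IsStd I z α} := by
        ext α
        simp only [Set.mem_ofPred_eq, Finset.mem_insert, Set.mem_insert_iff]
        constructor
        · rintro ⟨h | h, h'⟩
          · left; rw [← h]; rfl
          · right; exact ⟨h, h'⟩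
        · rintro (h | ⟨h, h'⟩)
          · subst h; exact ⟨Or.inl rfl, hs⟩
          · exact ⟨Or.inr h, h'⟩
      rw [hset, Set.ncard_insert_of_notMem (a := ofLex a) (fun h => haS h.1) hfin, ih', hWins]
      have hs' : mon z (ofLex a) ∉ W I z n (fun β => toLex β ∈ S) := by
        rw [hWeq, ← hda]; exact hs
      rw [length_step _ _ hs' (by
        intro b hb
        have := max_mul_mon _ I z hz hm (ofLex a) (by omega) b hb
        rw [hWeq, ← hda]; exact this)]
      push_cast
      rw [add_assoc, add_comm 1]
    · have hset : {α : Fin r → ℕ | toLex α ∈ insert a S ∧ IsStd I z α} =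
          {α : Fin r → ℕ | toLex α ∈ S ∧ IsStd I z α} := by
        ext α
        simp only [Set.mem_ofPred_eq, Finset.mem_insert]
        constructor
        · rintro ⟨h | h, h'⟩
          · exfalso; apply hs; rw [← h]; exact h'
          · exact ⟨h, h'⟩
        · rintro ⟨h, h'⟩
          exact ⟨Or.inr h, h'⟩
      have hs' : mon z (ofLex a) ∈ W I z n (fun β => toLex β ∈ S) := by
        rw [hWeq, ← hda]; exact not_not.1 hs
      rw [hset, ih', hWins, sup_eq_left.2]
      rw [Ideal.span_le, Set.singleton_subset_iff]
      exact hs'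

theorem length_deg [IsLocalRing A] (I : Ideal A) (z : Fin r → A) (hz : ∀ i, z i ∈ I)
    (hI : I ≤ Ideal.span (Set.range z) ⊔ I ^ 2)
    (hm : ∀ i, ∀ a ∈ maximalIdeal A, a * z i ∈ Ideal.span {w | ∃ j, i < j ∧ w = z j} ⊔ I ^ 2)
    (n : ℕ) (hn : 1 ≤ n) :
    Module.length A (A ⧸ I ^ (n + 1)) = Module.length A (A ⧸ I ^ n) +
      (({α : Fin r → ℕ | ∑ i, α i = n ∧ IsStd I z α}.ncard : ℕ) : ℕ∞) := by
  have hf : {α : Fin r → ℕ | ∑ i, α i = n}.Finite :=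
    (deg_finite n).subset (fun α (h : ∑ i, α i = n) => le_of_eq h)
  have hfin : {α : Lex (Fin r → ℕ) | ∑ i, (ofLex α) i = n}.Finite :=
    hf.preimage ofLex.injective.injOn
  have h := length_chain I z hz hm n hn hfin.toFinset (by simp) (by
    intro α _ β hβ _
    simpa using hβ)
  have h1 : W I z n (fun β => toLex β ∈ hfin.toFinset) = I ^ n := by
    apply le_antisymm (W_le_pow I z hz n _)
    refine (pow_le_W I z hz hI n).trans (W_mono _ _ _ _ _ fun β hβ _ => ?_)
    simpa using hβ
  rw [h, h1]
  simp

/-- The length function of an `𝔪`-primary ideal is, up to a constant, the Hilbert function of a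
multicomplex. -/
theorem length_eq_cnt [IsNoetherianRing A] [IsLocalRing A] (I : Ideal A) (hI : I ≠ ⊤)
    (hprimary : I.radical = maximalIdeal A) (len : ℕ → ℕ)
    (hlen : ∀ n, Module.length A (A ⧸ I ^ (n + 1)) = len n) :
    ∃ (r : ℕ) (Γ : LowerSet (Fin r → ℕ)) (c : ℕ),
      ∀ n, len n = c + cnt Finset.univ (Γ : Set (Fin r → ℕ)) n := by
  obtain ⟨k, hk⟩ := I.exists_radical_pow_le_of_fg (IsNoetherian.noetherian _)
  rw [hprimary] at hk
  obtain ⟨r, z, hz, hgen, hm⟩ := exists_gens _ I k hk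
  have hnt : Nontrivial (A ⧸ I ^ (0 + 1)) := by
    rw [zero_add, pow_one]
    exact Ideal.Quotient.nontrivial_iff.2 hI
  have hpos : 1 ≤ len 0 := by
    have h1 : 0 < Module.length A (A ⧸ I ^ (0 + 1)) := Module.length_pos
    rw [hlen 0] at h1
    exact_mod_cast h1
  have h0 : (0 : Fin r → ℕ) ∈ stdSet I z hz := by
    show mon z 0 ∉ _
    rw [mon_zero]
    intro h
    apply hI
    rw [Ideal.eq_top_iff_one]
    have hle : W I z (∑ i, (0 : Fin r → ℕ) i) (fun β => toLex β < toLex 0) ≤ I := by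
      refine sup_le (Ideal.span_le.2 ?_) (by simp)
      rintro _ ⟨β, h1, h2, rfl⟩
      exfalso
      have : β = 0 := by
        funext i
        have h1' : ∑ i, β i = 0 := by simpa using h1
        exact (Finset.sum_eq_zero_iff.1 h1') i (Finset.mem_univ i)
      subst this
      exact lt_irrefl _ h2
    exact hle h
  refine ⟨r, stdSet I z hz, len 0 - 1, ?_⟩
  intro n
  induction n with
  | zero =>
    rw [cnt_zero _ _ h0]; omega
  | succ n ih =>
    have h1 := length_deg I z hz hgen hm (n + 1) (by omega)
    rw [hlen, hlen] at h1
    have h2 : len (n + 1) = len n + {α : Fin r → ℕ | ∑ i, α i = n + 1 ∧ IsStd I z α}.ncard := by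
      exact_mod_cast h1
    have h3 : cset Finset.univ (stdSet I z hz : Set (Fin r → ℕ)) (n + 1) =
        cset Finset.univ (stdSet I z hz : Set (Fin r → ℕ)) n ∪
          {α : Fin r → ℕ | ∑ i, α i = n + 1 ∧ IsStd I z α} := by
      ext α
      constructor
      · rintro ⟨a1, a2, a3⟩
        rcases Nat.lt_or_ge (∑ i, α i) (n + 1) with h | h
        · left; exact ⟨a1, a2, by omega⟩
        · right; exact ⟨by omega, a1⟩
      · rintro (⟨a1, a2, a3⟩ | ⟨a1, a2⟩)
        · exact ⟨a1, a2, by omega⟩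
        · exact ⟨a2, by simp, by omega⟩
    have h4 : cnt Finset.univ (stdSet I z hz : Set (Fin r → ℕ)) (n + 1) =
        cnt Finset.univ (stdSet I z hz : Set (Fin r → ℕ)) n +
          {α : Fin r → ℕ | ∑ i, α i = n + 1 ∧ IsStd I z α}.ncard := by
      unfold cnt
      rw [h3, Set.ncard_union_eq _ (cset_finite _ _ _)
        ((deg_finite (n + 1)).subset fun α h => h.1.le)]
      rw [Set.disjoint_left]
      rintro α ⟨_, _, a3⟩ ⟨b1, _⟩
      omega
    omega

end HB

/-- Corollary 2.3. Let `(A, 𝔪)` be a Noetherian local ring of dimension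
`d ≥ 1` with infinite residue field and `I` an `𝔪`-primary ideal with `A/I`
equicharacteristic (it contains a field). The Hilbert coefficients `e_i(I)` are
defined by `ℓ(A/I^{n+1}) = Σ_{i=0}^{d} (-1)^i e_i(I) C(n+d-i, d-i)` for `n ≫ 0`.
Then for all `1 ≤ i ≤ d`,
`(-1)^{i-1} e_i(I) < (7/12)(ξ_{i-1}(I) + 1)^{2^i} - e_0(I)`, where
`ξ_{i-1}(I) = max{e_0(I), |e_1(I)|, …, |e_{i-1}(I)|}`. -/
theorem stmt10 (A : Type*) [CommRing A] [IsNoetherianRing A] [IsLocalRing A]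
    (d : ℕ) (hd : 1 ≤ d) (hdim : ringKrullDim A = d)
    (hres : Infinite (IsLocalRing.ResidueField A))
    (I : Ideal A) (hI : I ≠ ⊤) (hprimary : I.radical = IsLocalRing.maximalIdeal A)
    (hequichar : ∃ F : Subring (A ⧸ I), IsField F)
    -- `len n = ℓ(A/I^{n+1})`
    (len : ℕ → ℕ) (hlen : ∀ n, HasLength A (A ⧸ I ^ (n + 1)) (len n))
    -- the Hilbert coefficients `e_0(I), …, e_d(I)` of `I`
    (e : ℕ → ℤ)
    (he : ∃ N, ∀ n ≥ N, (len n : ℤ) =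
      ∑ i ∈ Finset.range (d + 1), (-1) ^ i * e i * ((n + d - i).choose (d - i) : ℤ))
    :
    ∀ i, 1 ≤ i → i ≤ d →
      ((-1) ^ (i - 1) * e i : ℚ) <
        7 / 12 * (((Finset.Icc 1 (i - 1)).fold max (e 0) (fun k => |e k|) : ℚ) + 1) ^ (2 ^ i)
          - (e 0 : ℚ) := by
  have hlen' : ∀ n, Module.length A (A ⧸ I ^ (n + 1)) = len n := by
    intro n
    obtain ⟨s, h1, h2, h3⟩ := hlen n
    rw [← Module.length_compositionSeries s h1 h2, h3]
  obtain ⟨r, Γ, c, hc⟩ := HB.length_eq_cnt I hI hprimary len hlen'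
  obtain ⟨T, hT, hstd, -⟩ := HB.decomp Finset.univ Γ
  obtain ⟨N, hN⟩ := he
  obtain ⟨s, s0, smono, hs⟩ := HB.coeffs d T hstd c e len
    (fun n => by rw [hc n, hT n]) N hN
  let F : ℕ → ℤ := fun q => (Finset.Icc 1 q).fold max (e 0) (fun k => |e k|)
  have he0 : 0 ≤ e 0 := by
    have h := hs 0 (Nat.zero_le d)
    rw [if_neg (by omega)] at h
    simp [s0] at h
    omega
  have hF0 : ∀ q, e 0 ≤ F q := fun q => (Finset.le_fold_max _).2 (Or.inl le_rfl)
  have hFk : ∀ q k, 1 ≤ k → k ≤ q → |e k| ≤ F q := fun q k h1 h2 =>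
    (Finset.le_fold_max _).2 (Or.inr ⟨k, Finset.mem_Icc.2 ⟨h1, h2⟩, le_rfl⟩)
  have hFm : Monotone F := by
    intro a b hab
    refine (Finset.fold_max_le _).2 ⟨hF0 b, fun k hk => ?_⟩
    rw [Finset.mem_Icc] at hk
    exact hFk b k hk.1 (hk.2.trans hab)
  have hpos : ∀ q, 0 ≤ F q := fun q => he0.trans (hF0 q)
  have hX : ∀ q, (((F q).toNat : ℕ) : ℤ) = F q := fun q => Int.toNat_of_nonneg (hpos q)
  have hfin := HB.numeric d hd c e s s0 smono hs (fun q => (F q).toNat)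
    (fun a b hab => Int.toNat_le_toNat (hFm hab)) (by
      intro q k hkq _
      show |e k| ≤ (((F q).toNat : ℕ) : ℤ)
      rw [hX q]
      rcases Nat.eq_zero_or_pos k with h | h
      · subst h
        rw [abs_of_nonneg he0]
        exact hF0 q
      · exact hFk q k h hkq)
  intro i hi hid
  have hmain := hfin i hi hid
  have hcast : (((F (i - 1)).toNat : ℕ) : ℚ) =
      (Finset.Icc 1 (i - 1)).fold max (e 0 : ℚ) (fun k => |(e k : ℚ)|) := by
    have h1 : (((F (i - 1)).toNat : ℕ) : ℚ) = ((F (i - 1) : ℤ) : ℚ) := by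
      exact_mod_cast congrArg (fun t : ℤ => (t : ℚ)) (hX (i - 1))
    rw [h1]
    have h2 := Finset.fold_hom (op := max) (op' := max) (s := Finset.Icc 1 (i - 1)) (b := e 0)
      (f := fun k => |e k|) (m := fun t : ℤ => (t : ℚ)) (fun x y => Int.cast_max)
    simp only [Int.cast_abs] at h2
    exact h2.symm
  simp only [hcast] at hmain
  exact hmain
end
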